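/- arXiv:1808.02680 — 6 statements merged into one kernel-verified Lean document; each statement's English description precedes it below -/
import Mathlib

section
/- A bLSP endomorphism f of A* preserves the LSP property for infinite words (that is, f(w) is LSP for every infinite LSP word w over A) if and only if f = L_α for some letter α ∈ A. -/
section LSPDefs

variable {A : Type*} {B : Type*}

/-- `u` is a prefix of the infinite word `w`. -/
def IsPrefixI (u : List A) (w : ℕ → A) : Prop :=
  ∀ (i : ℕ) (h : i < u.length), u.get ⟨i, h⟩ = w i

/-- `u` is a factor of the infinite word `w`. -/
def IsFactorI (u : List A) (w : ℕ → A) : Prop :=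
  ∃ k : ℕ, ∀ (i : ℕ) (h : i < u.length), u.get ⟨i, h⟩ = w (k + i)

/-- `u` is a left special factor of the infinite word `w`. -/
def LeftSpecialI (u : List A) (w : ℕ → A) : Prop :=
  ∃ a b : A, a ≠ b ∧ IsFactorI (a :: u) w ∧ IsFactorI (b :: u) w

/-- An infinite word is LSP if all its left special factors are prefixes of it. -/
def IsLSP (w : ℕ → A) : Prop :=
  ∀ u : List A, LeftSpecialI u w → IsPrefixI u w

/-- Application of a morphism (given by images of letters) to a finite word. -/
def applyM (f : A → List B) (u : List A) : List B := (u.map f).flatten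

/-- The prefix of length `n` of an infinite word. -/
def infPrefix (w : ℕ → A) (n : ℕ) : List A := List.ofFn (fun i : Fin n => w i)

/-- `x` is the image of the infinite word `w` under the morphism `f`. -/
def InfImage (f : A → List B) (w : ℕ → A) (x : ℕ → B) : Prop :=
  ∀ n : ℕ, IsPrefixI (applyM f (infPrefix w n)) x

/-- `f` is a basic LSP (bLSP) endomorphism. -/
def IsBLSP (f : A → List A) : Prop :=
  ∃ α : A, f α = [α] ∧ ∀ β : A, β ≠ α → ∃ γ : A, f β = f γ ++ [β]

/-- `f` is an R-bLSP morphism with domain alphabet `D`: the restriction to `D` of a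
bLSP morphism `g` (letters outside the domain are sent to `[]`). -/
def IsRBLSPOn (D : Set A) (f : A → List A) : Prop :=
  (∀ x : A, x ∈ D ↔ f x ≠ []) ∧ ∃ g : A → List A, IsBLSP g ∧ ∀ x ∈ D, f x = g x

/-- The episturmian morphism `L_α`. -/
def Lmor [DecidableEq A] (α : A) : A → List A := fun β => if β = α then [α] else [α, β]

/-- `u` is an `(a,b,c,β,γ)`-fragility of `w`. -/
def Frag5 (w : ℕ → A) (a b c β γ : A) (u : List A) : Prop :=
  IsPrefixI (u ++ [a]) w ∧ IsFactorI (β :: (u ++ [b])) w ∧ IsFactorI (γ :: (u ++ [c])) w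

/-- `w` is `(a,b,c)`-fragile. -/
def Fragile (w : ℕ → A) (a b c : A) : Prop :=
  ∃ (u : List A) (β γ : A), β ≠ γ ∧ Frag5 w a b c β γ u

/-- `f` is LSP `(a,b,c)`-breaking (for words over the domain `D` of `f`). -/
def Breaking (D : Set A) (f : A → List A) (a b c : A) : Prop :=
  ∀ (w x : ℕ → A), Set.range w ⊆ D → IsLSP w → Fragile w a b c →
    InfImage f w x → ¬ IsLSP x

/-- Length of the longest common prefix of two finite words. -/
noncomputable def lcpLen (u v : List A) : ℕ :=
  sSup {n | n ≤ u.length ∧ n ≤ v.length ∧ u.take n = v.take n}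

/-- A morphism is nonerasing if images of letters are nonempty. -/
def Nonerasing (f : A → List B) : Prop := ∀ a : A, f a ≠ []

/-- `f` preserves the LSP property for infinite words. -/
def PreservesLSP (f : A → List B) : Prop :=
  ∀ (w : ℕ → A) (x : ℕ → B), IsLSP w → InfImage f w x → IsLSP x

/-- `f ∈ U(A,B)`: nonerasing and each letter of `B` occurs at most once in total
among the images of letters. -/
def InU [Fintype A] [DecidableEq B] (f : A → List B) : Prop :=
  Nonerasing f ∧ ∀ b : B, (∑ a : A, (f a).count b) ≤ 1

/-- `u^k`. -/
def listPow (u : List B) (k : ℕ) : List B := (List.replicate k u).flatten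

/-- `x = u^ω`. -/
def IsOmegaPow (u : List B) (x : ℕ → B) : Prop := ∀ k : ℕ, IsPrefixI (listPow u k) x

/-- `f ∈ P_LSP(A,B)`: nonerasing, all images are positive powers of a word `u`
with `u^ω` LSP. -/
def InPLSP (f : A → List B) : Prop :=
  Nonerasing f ∧ ∃ u : List B, u ≠ [] ∧ (∀ a : A, ∃ k : ℕ, 0 < k ∧ f a = listPow u k) ∧
    ∀ x : ℕ → B, IsOmegaPow u x → IsLSP x

/-- `r` is the primitive root of `w`. -/
def IsPrimRoot (r w : List B) : Prop :=
  (∃ k : ℕ, 0 < k ∧ w = listPow r k) ∧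
  ∀ (v : List B) (k : ℕ), 0 < k → w = listPow v k → r.length ≤ v.length

/-- Compatibility of a chain of morphisms `[g_1, …, g_n]` (composition
`g_1 ∘ ⋯ ∘ g_n`): every letter produced by `g_{i+1}` lies in the domain of `g_i`. -/
def CompatChain (L : List (B → List B)) : Prop :=
  List.Chain' (fun g h => ∀ x y, y ∈ h x → g y ≠ []) L

end LSPDefs

theorem infPrefix_succ_aux {A : Type*} (w : ℕ → A) (n : ℕ) :
    infPrefix w (n+1) = infPrefix w n ++ [w n] := by
  unfold infPrefix
  rw [List.ofFn_succ']
  simp [List.concat_eq_append]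

theorem applyM_succ_aux {A : Type*} (f : A → List A) (w : ℕ → A) (n : ℕ) :
    applyM f (infPrefix w (n+1)) = applyM f (infPrefix w n) ++ f (w n) := by
  rw [infPrefix_succ_aux]; simp [applyM]

theorem applyM_prefix_aux {A : Type*} (f : A → List A) (w : ℕ → A) {n m : ℕ} (h : n ≤ m) :
    applyM f (infPrefix w n) <+: applyM f (infPrefix w m) := by
  induction m, h using Nat.le_induction with
  | base => exact List.prefix_refl _
  | succ m _ ih =>
    rw [applyM_succ_aux]
    exact ih.trans (List.prefix_append _ _)

theorem applyM_length_aux {A : Type*} (f : A → List A) (hf : ∀ a, f a ≠ []) (w : ℕ → A) (n : ℕ) :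
    n ≤ (applyM f (infPrefix w n)).length := by
  induction n with
  | zero => simp
  | succ n ih =>
    rw [applyM_succ_aux, List.length_append]
    have := List.length_pos_of_ne_nil (hf (w n))
    omega

theorem exists_image_aux {A : Type*} (f : A → List A) (hf : ∀ a, f a ≠ []) (w : ℕ → A) :
    ∃ x, InfImage f w x := by
  have hl : ∀ i, i < (applyM f (infPrefix w (i+1))).length :=
    fun i => applyM_length_aux f hf w (i+1)
  refine ⟨fun i => (applyM f (infPrefix w (i+1)))[i]'(hl i), ?_⟩
  intro n i h
  simp only [List.get_eq_getElem]
  rcases le_total n (i+1) with h1 | h1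
  · exact (applyM_prefix_aux f w h1).getElem h
  · exact ((applyM_prefix_aux f w h1).getElem (hl i)).symm

theorem image_get_aux {A : Type*} (f : A → List A) (w x : ℕ → A) (h : InfImage f w x)
    (n i : ℕ) (hi : i < (f (w n)).length) :
    x ((applyM f (infPrefix w n)).length + i) = (f (w n))[i] := by
  have := h (n+1) ((applyM f (infPrefix w n)).length + i)
    (by rw [applyM_succ_aux, List.length_append]; omega)
  rw [← this]
  simp [applyM_succ_aux]

theorem core_aux {A : Type*} [DecidableEq A] (α : A) (w x : ℕ → A) (p : ℕ → ℕ)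
    (hs : ∀ n, p (n+1) = p n + if w n = α then 1 else 2)
    (h0 : ∀ n, x (p n) = α) (h1 : ∀ n, x (p n + 1) = w n) (l : ℕ) :
    ∀ j j', (∀ i < l, x (p j + i) = x (p j' + i)) →
    ∃ t, (∀ i < t, w (j+i) = w (j'+i)) ∧
      ∀ n, (∀ i < t, w (n+i) = w (j+i)) → ∀ i < l, x (p n + i) = x (p j + i) := by
  induction l using Nat.strong_induction_on with
  | _ l ih =>
  intro j j' hx
  by_cases hl : l ≤ 1
  · refine ⟨0, by simp, fun n _ i hi => ?_⟩
    obtain rfl : i = 0 := by omega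
    simp [h0]
  · have hw : w j = w j' := by rw [← h1, ← h1]; exact hx 1 (by omega)
    obtain ⟨s, hsdef⟩ : ∃ s, s = if w j = α then 1 else 2 := ⟨_, rfl⟩
    have hs12 : s = 1 ∨ s = 2 := by split_ifs at hsdef <;> simp [hsdef]
    have e1 : p (j+1) = p j + s := by rw [hs, hsdef]
    have e2 : p (j'+1) = p j' + s := by rw [hs, hsdef, hw]
    obtain ⟨t, ht, hn⟩ := ih (l - s) (by omega) (j+1) (j'+1) (by
      intro i hi
      rw [e1, e2, add_assoc, add_assoc]
      exact hx _ (by omega))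
    refine ⟨t+1, ?_, ?_⟩
    · intro i hi
      rcases i with _ | i
      · exact hw
      · have := ht i (by omega)
        rwa [add_assoc, add_assoc, add_comm 1 i] at this
    · intro n hni i hi
      have hwn : w n = w j := hni 0 (by omega)
      have e3 : p (n+1) = p n + s := by rw [hs, hsdef, hwn]
      by_cases his : i < s
      · obtain rfl | rfl : i = 0 ∨ i = 1 := by omega
        · simp [h0]
        · rw [h1, h1, hwn]
      · have := hn (n+1) (by
          intro i hi
          have := hni (i+1) (by omega)
          rwa [add_assoc, add_assoc, add_comm 1 i]) (i - s) (by omega)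
        rw [e1, e3, add_assoc, add_assoc] at this
        rwa [show s + (i - s) = i by omega] at this

theorem Lmor_preserves_aux {A : Type*} [DecidableEq A] (α : A) : PreservesLSP (Lmor α) := by
  intro w x hw hx
  obtain ⟨p, hp⟩ : ∃ p : ℕ → ℕ, ∀ n, p n = (applyM (Lmor α) (infPrefix w n)).length :=
    ⟨_, fun _ => rfl⟩
  have p0 : p 0 = 0 := by rw [hp]; simp [applyM, infPrefix]
  have hs : ∀ n, p (n+1) = p n + if w n = α then 1 else 2 := by
    intro n
    rw [hp, hp, applyM_succ_aux, List.length_append]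
    unfold Lmor; split_ifs <;> rfl
  have h0 : ∀ n, x (p n) = α := by
    intro n
    have := image_get_aux _ w x hx n 0 (by unfold Lmor; split_ifs <;> simp)
    rw [← hp] at this
    rw [add_zero] at this
    rw [this]; unfold Lmor; split_ifs <;> simp
  have h1 : ∀ n, x (p n + 1) = w n := by
    intro n
    by_cases h : w n = α
    · have h2 := h0 (n+1)
      rw [hs, if_pos h] at h2
      rw [h2, h]
    · have := image_get_aux _ w x hx n 1 (by simp [Lmor, h])
      rw [← hp] at this
      rw [this]; simp [Lmor, h]
  have hcov : ∀ k, ∃ n, k = p n ∨ (k = p n + 1 ∧ w n ≠ α) := by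
    intro k
    induction k with
    | zero => exact ⟨0, Or.inl p0.symm⟩
    | succ k ih =>
      obtain ⟨n, h | ⟨h, h'⟩⟩ := ih
      · by_cases hn : w n = α
        · exact ⟨n+1, Or.inl (by rw [hs, if_pos hn, h])⟩
        · exact ⟨n, Or.inr ⟨by rw [h], hn⟩⟩
      · exact ⟨n+1, Or.inl (by rw [hs, if_neg h', h])⟩
  have hprev : ∀ k, x (k+1) = α → ∃ n, k + 1 = p (n+1) ∧ x k = w n := by
    intro k hk
    obtain ⟨n, h | ⟨h, h'⟩⟩ := hcov (k+1)
    · rcases n with _ | n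
      · omega
      · refine ⟨n, h, ?_⟩
        have := hs n
        split_ifs at this with hn
        · rw [show k = p n by omega, h0, hn]
        · rw [show k = p n + 1 by omega, h1]
    · rw [h, h1] at hk; exact absurd hk h'
  have hother : ∀ k, x (k+1) ≠ α → x k = α := by
    intro k hk
    obtain ⟨n, h | ⟨h, h'⟩⟩ := hcov (k+1)
    · rw [h, h0] at hk; exact absurd rfl hk
    · rw [show k = p n by omega, h0]
  rintro u ⟨a, b, hab, ⟨k, hk⟩, ⟨k', hk'⟩⟩
  have ka : a = x k := hk 0 (by simp)
  have kb : b = x k' := hk' 0 (by simp)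
  have ku : ∀ i (h : i < u.length), u[i] = x (k + 1 + i) := by
    intro i h
    have := hk (i+1) (by simpa using h)
    simpa [add_assoc, add_comm 1] using this
  have ku' : ∀ i (h : i < u.length), u[i] = x (k' + 1 + i) := by
    intro i h
    have := hk' (i+1) (by simpa using h)
    simpa [add_assoc, add_comm 1] using this
  intro i hi
  have hpos : 0 < u.length := by omega
  have z1 := ku 0 hpos
  have z2 := ku' 0 hpos
  rw [add_zero] at z1 z2
  by_cases hα : u[0] = α
  · obtain ⟨n, e, en⟩ := hprev k (z1.symm.trans hα)
    obtain ⟨n', e', en'⟩ := hprev k' (z2.symm.trans hα)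
    obtain ⟨t, ht, hn⟩ := core_aux α w x p hs h0 h1 u.length (n+1) (n'+1) (by
      intro i hi
      rw [← e, ← e', ← ku i hi, ← ku' i hi])
    have hpre := hw (List.ofFn (fun i : Fin t => w (n+1+i))) ⟨a, b, hab, ⟨n, ?_⟩, ⟨n', ?_⟩⟩
    · have := hn 0 (by
        intro i hi
        have := hpre i (by simpa using hi)
        rw [zero_add, ← this]
        simp) i hi
      rw [p0, zero_add, ← e, ← ku i hi] at this
      exact this.symm
    · intro i hi
      rcases i with _ | i
      · simp [ka, en]
      · simp [add_assoc, add_comm 1]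
    · intro i hi
      rcases i with _ | i
      · simp [kb, en']
      · have := ht i (by simpa using hi)
        simp only [List.get_eq_getElem, List.getElem_cons_succ, List.getElem_ofFn]
        rw [this, add_assoc, add_comm 1 i]
  · exfalso
    apply hab
    rw [ka, kb, hother k (by rwa [← z1]), hother k' (by rwa [← z2])]

theorem blsp_chain_aux {A : Type*} [DecidableEq A] (f : A → List A) (α : A) (h0 : f α = [α])
    (h : ∀ β : A, β ≠ α → ∃ γ : A, f β = f γ ++ [β]) (l : ℕ) :
    ∀ γ, (f γ).length = l → f γ ≠ Lmor α γ →
      ∃ β γ, β ≠ α ∧ γ ≠ α ∧ f β = [α, β] ∧ f γ = [α, β, γ] := by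
  induction l using Nat.strong_induction_on with
  | _ l ih =>
  intro γ hl hne
  have hγ : γ ≠ α := by
    rintro rfl
    exact hne (by simp [h0, Lmor])
  obtain ⟨δ, hδ⟩ := h γ hγ
  have hδα : δ ≠ α := by
    rintro rfl
    exact hne (by simp [hδ, h0, Lmor, hγ])
  by_cases hd : f δ = Lmor α δ
  · have hd' : f δ = [α, δ] := by simpa [Lmor, hδα] using hd
    exact ⟨δ, γ, hδα, hγ, hd', by simp [hδ, hd']⟩
  · exact ih (f δ).length (by rw [← hl, hδ]; simp) δ rfl hd

/-- a bLSP endomorphism preserves the LSP property iff it is `L_α`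
for some letter `α`. -/
theorem blsp_preserves_iff_L {A : Type*} [DecidableEq A] (f : A → List A)
    (hf : IsBLSP f) :
    PreservesLSP f ↔ ∃ α : A, f = Lmor α := by
  constructor
  · intro hp
    obtain ⟨α, h0, h⟩ := hf
    refine ⟨α, ?_⟩
    by_contra hne
    obtain ⟨c, hc⟩ := Function.ne_iff.mp hne
    obtain ⟨β, γ, hβ, hγ, fβ, fγ⟩ := blsp_chain_aux f α h0 h _ c rfl hc
    have hβγ : β ≠ γ := by
      rintro rfl
      rw [fβ] at fγ; simp at fγ
    have hne0 : ∀ a, f a ≠ [] := by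
      intro a ha
      by_cases haα : a = α
      · subst haα; simp [h0] at ha
      · obtain ⟨g, hg⟩ := h a haα
        simp [hg] at ha
    let w : ℕ → A := fun n => if n % 3 = 0 then α else if n % 3 = 1 then β else γ
    have hprev : ∀ m n, w (m+1) = w (n+1) → w m = w n := by
      intro m n hmn
      have hm : m % 3 = 0 ∨ m % 3 = 1 ∨ m % 3 = 2 := by omega
      have hn : n % 3 = 0 ∨ n % 3 = 1 ∨ n % 3 = 2 := by omega
      have hm1 : (m+1) % 3 = (m % 3 + 1) % 3 := by omega
      have hn1 : (n+1) % 3 = (n % 3 + 1) % 3 := by omega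
      simp only [w, hm1, hn1] at hmn ⊢
      rcases hm with e | e | e <;> rcases hn with e' | e' | e' <;>
        simp [e, e', hβ, hγ, hβγ, hβ.symm, hγ.symm, hβγ.symm] at hmn ⊢
    have hw : IsLSP w := by
      rintro u ⟨a, b, hab, ⟨k, hk⟩, ⟨k', hk'⟩⟩ i hi
      exfalso
      have hu : 0 < u.length := by omega
      have a0 : a = w k := hk 0 (by simp)
      have b0 : b = w k' := hk' 0 (by simp)
      have a1 := hk 1 (by simpa using hu)
      have b1 := hk' 1 (by simpa using hu)
      exact hab (by rw [a0, b0]; exact hprev _ _ (a1.symm.trans b1))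
    obtain ⟨x, hx⟩ := exists_image_aux f hne0 w
    have hL : applyM f (infPrefix w 3) = [α, α, β, α, β, γ] := by
      simp [applyM, infPrefix, w, h0, fβ, fγ]
    have h3 := hx 3
    rw [hL] at h3
    have x0 : α = x 0 := h3 0 (by simp)
    have x1 : α = x 1 := h3 1 (by simp)
    have x2 : β = x 2 := h3 2 (by simp)
    have x3 : α = x 3 := h3 3 (by simp)
    have x4 : β = x 4 := h3 4 (by simp)
    have hpre := hp w x hw hx [α, β] ⟨α, β, hβ.symm, ⟨0, ?_⟩, ⟨2, ?_⟩⟩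
    · have : β = x 1 := hpre 1 (by simp)
      exact hβ (this.trans x1.symm)
    · intro i hi
      have : i < 3 := hi
      interval_cases i
      · exact x0
      · exact x1
      · exact x2
    · intro i hi
      have : i < 3 := hi
      interval_cases i
      · exact x2
      · exact x3
      · exact x4
  · rintro ⟨α, rfl⟩
    exact Lmor_preserves_aux α
end

section
/- If a bLSP endomorphism f of A* is not equal to L_α for any letter α, then f is LSP (a,b,c)-breaking for some pairwise distinct letters a, b, c of A. -/
theorem factor_mid {A : Type*} (p v s : List A) (x : ℕ → A)
    (h : IsFactorI (p ++ v ++ s) x) : IsFactorI v x := by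
  obtain ⟨k, hk⟩ := h
  refine ⟨k + p.length, fun i hi => ?_⟩
  have := hk (p.length + i) (by simp; omega)
  simp only [List.get_eq_getElem, List.append_assoc] at this ⊢
  rw [List.getElem_append_right (by omega), List.getElem_append_left (by omega)] at this
  rw [add_assoc, ← this]
  simp

theorem prefix_factor {A : Type*} (v : List A) (x : ℕ → A)
    (h : IsPrefixI v x) : IsFactorI v x :=
  ⟨0, fun i hi => by simpa using h i hi⟩

theorem infPrefix_append {A : Type*} (v : List A) (w : ℕ → A) (k : ℕ)
    (h : ∀ (i : ℕ) (h : i < v.length), v.get ⟨i, h⟩ = w (k + i)) :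
    infPrefix w (k + v.length) = infPrefix w k ++ v := by
  apply List.ext_getElem
  · simp [infPrefix]
  · intro i h1 h2
    simp only [infPrefix, List.length_ofFn] at h1
    by_cases hi : i < k
    · rw [List.getElem_append_left (by simpa [infPrefix] using hi)]
      simp [infPrefix]
    · rw [List.getElem_append_right (by simp [infPrefix]; omega)]
      have := h (i - k) (by omega)
      simp only [List.get_eq_getElem] at this
      simp only [infPrefix, List.length_ofFn, List.getElem_ofFn]
      rw [this]
      congr 1
      omega

theorem factor_image {A : Type*} (f : A → List A) (v : List A) (w x : ℕ → A)
    (hx : InfImage f w x) (h : IsFactorI v w) : IsFactorI (applyM f v) x := by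
  obtain ⟨k, hk⟩ := h
  have h1 := prefix_factor _ _ (hx (k + v.length))
  rw [infPrefix_append v w k hk] at h1
  refine factor_mid (applyM f (infPrefix w k)) _ [] x ?_
  simpa [applyM] using h1

theorem blsp_not_L_breaking {A : Type*} [DecidableEq A] (f : A → List A)
    (hf : IsBLSP f) (h : ¬ ∃ α : A, f = Lmor α) :
    ∃ a b c : A, a ≠ b ∧ b ≠ c ∧ a ≠ c ∧ Breaking Set.univ f a b c := by
  obtain ⟨α, hα, hβ⟩ := hf
  have hlast : ∀ y, ∃ p, f y = p ++ [y] := by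
    intro y
    by_cases hy : y = α
    · exact ⟨[], by simp [hy, hα]⟩
    · obtain ⟨γ, hγ⟩ := hβ y hy
      exact ⟨_, hγ⟩
  -- every image starts with α, and is `[α]`, `[α, y]`, or there is a letter of depth two
  have key : ∀ n y, (f y).length = n → (∃ t, f y = α :: t) ∧
      (y = α ∨ f y = [α, y] ∨ ∃ b c, b ≠ α ∧ c ≠ α ∧ f b = [α, b] ∧ f c = [α, b, c]) := by
    intro n
    induction n using Nat.strong_induction_on with
    | _ n ih =>
      intro y hy
      by_cases hyα : y = α
      · exact ⟨⟨[], by rw [hyα, hα]⟩, Or.inl hyα⟩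
      · obtain ⟨γ, hγ⟩ := hβ y hyα
        obtain ⟨⟨t, ht⟩, h2⟩ := ih (f γ).length (by rw [← hy, hγ]; simp) γ rfl
        refine ⟨⟨t ++ [y], by rw [hγ, ht]; simp⟩, Or.inr ?_⟩
        rcases h2 with h2 | h2 | h2
        · left; rw [hγ, h2, hα]; rfl
        · right
          by_cases hγα : γ = α
          · rw [hγα, hα] at h2; simp at h2
          · exact ⟨γ, y, hγα, hyα, h2, by rw [hγ, h2]; rfl⟩
        · exact Or.inr h2
  have hstart : ∀ y, ∃ t, f y = α :: t := fun y => (key _ y rfl).1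
  obtain ⟨b, c, hb, hc, fb, fc⟩ :
      ∃ b c, b ≠ α ∧ c ≠ α ∧ f b = [α, b] ∧ f c = [α, b, c] := by
    by_contra hcon
    apply h
    refine ⟨α, funext fun y => ?_⟩
    rcases (key _ y rfl).2 with h2 | h2 | h2
    · simp [Lmor, h2, hα]
    · by_cases hy : y = α
      · simp [Lmor, hy, hα]
      · simp [Lmor, hy, h2]
    · exact absurd h2 hcon
  have hbc : b ≠ c := by
    rintro rfl
    rw [fb] at fc
    simp at fc
  refine ⟨α, b, c, hb.symm, hbc, hc.symm, ?_⟩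
  rintro w x - - ⟨u, β, γ, hne, hp, hfb, hfc⟩ hx hLSP
  have h1 := factor_image f _ w x hx hfb
  have h2 := factor_image f _ w x hx hfc
  obtain ⟨p, hp1⟩ := hlast β
  obtain ⟨q, hq1⟩ := hlast γ
  have h1' : IsFactorI (β :: (applyM f u ++ [α, b])) x := by
    refine factor_mid p _ [] x ?_
    simpa [applyM, hp1, fb] using h1
  have h2' : IsFactorI (γ :: (applyM f u ++ [α, b])) x := by
    refine factor_mid q _ [c] x ?_
    simpa [applyM, hq1, fc] using h2
  have hpre := hLSP _ ⟨β, γ, hne, h1', h2'⟩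
  have e1 := infPrefix_append (u ++ [α]) w 0 (fun i hi => by simpa using hp i hi)
  have e2 := infPrefix_append [w (0 + (u ++ [α]).length)] w (0 + (u ++ [α]).length)
    (fun i hi => by
      have : i = 0 := by simpa using hi
      subst this; rfl)
  have e3 := hx (0 + (u ++ [α]).length + [w (0 + (u ++ [α]).length)].length)
  rw [e2, e1] at e3
  obtain ⟨t, ht⟩ := hstart (w (0 + (u ++ [α]).length))
  have e4 : applyM f (infPrefix w 0 ++ (u ++ [α]) ++ [w (0 + (u ++ [α]).length)])
      = applyM f u ++ ([α, α] ++ t) := by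
    simp only [applyM, List.map_append, List.flatten_append, List.map_cons, List.map_nil,
      List.flatten_cons, List.flatten_nil, ht, hα]
    simp [infPrefix]
  rw [e4] at e3
  have a1 := e3 ((applyM f u).length + 1) (by simp)
  have a2 := hpre ((applyM f u).length + 1) (by simp)
  rw [← a1] at a2
  simp only [List.get_eq_getElem] at a2
  rw [List.getElem_append_right (by omega), List.getElem_append_right (by omega)] at a2
  simp at a2
  exact hb a2
end

section
/- Let α be a letter, let a, b, c be three pairwise distinct letters, and let w be an infinite word. Then w contains an (a,b,c)-fragility if and only if L_α(w) contains an (a,b,c)-fragility. -/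
theorem fragile_iff_fun {A : Type*} (w : ℕ → A) (a b c : A) :
    Fragile w a b c ↔ ∃ n k l, w n = a ∧ w k ≠ w l ∧
      ((∀ i < n, w (k + 1 + i) = w i) ∧ w (k + 1 + n) = b) ∧
      ((∀ i < n, w (l + 1 + i) = w i) ∧ w (l + 1 + n) = c) := by
  have aux : ∀ (u : List A) (a b β : A), IsPrefixI (u ++ [a]) w →
      ∀ k, (∀ (i : ℕ) (h : i < (β :: (u ++ [b])).length),
        (β :: (u ++ [b])).get ⟨i, h⟩ = w (k + i)) →
      w k = β ∧ (∀ i < u.length, w (k + 1 + i) = w i) ∧ w (k + 1 + u.length) = b := by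
    intro u a b β hp k hk
    refine ⟨?_, ?_, ?_⟩
    · have := hk 0 (by simp)
      simpa using this.symm
    · intro i hi
      have h1 := hp i (by simp; omega)
      have h2 := hk (i+1) (by simp; omega)
      simp [List.getElem_append_left hi] at h1 h2
      rw [← h1, h2]; congr 1; omega
    · have h2 := hk (u.length+1) (by simp)
      simp at h2
      rw [h2]; congr 1; omega
  have aux2 : ∀ n k b, (∀ i < n, w (k + 1 + i) = w i) → w (k + 1 + n) = b →
      IsFactorI (w k :: (infPrefix w n ++ [b])) w := by
    intro n k b h hb
    refine ⟨k, ?_⟩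
    intro i hi
    rcases i with _ | i
    · simp
    · simp [infPrefix] at hi
      rcases Nat.lt_or_ge i n with h' | h'
      · have := h i h'
        simp [infPrefix, List.getElem_append, h']
        rw [← this]; congr 1; omega
      · obtain rfl : i = n := by omega
        simp [infPrefix]
        rw [← hb]; congr 1; omega
  constructor
  · rintro ⟨u, β, γ, hne, hp, ⟨k, hk⟩, ⟨l, hl⟩⟩
    obtain ⟨h1, h2⟩ := aux u a b β hp k hk
    obtain ⟨h3, h4⟩ := aux u a c γ hp l hl
    refine ⟨u.length, k, l, ?_, ?_, h2, h4⟩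
    · have := hp u.length (by simp)
      simpa using this.symm
    · rw [h1, h3]; exact hne
  · rintro ⟨n, k, l, ha, hne, ⟨h1, h2⟩, h3, h4⟩
    refine ⟨infPrefix w n, w k, w l, hne, ?_, aux2 n k b h1 h2, aux2 n l c h3 h4⟩
    intro i hi
    simp [infPrefix] at hi
    rcases Nat.lt_or_ge i n with h' | h'
    · simp [infPrefix, List.getElem_append, h']
    · obtain rfl : i = n := by omega
      simp [infPrefix, ha]

theorem exists_pos {A : Type*} [DecidableEq A] (α : A) (w x : ℕ → A)
    (hx : InfImage (Lmor α) w x) :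
    ∃ p : ℕ → ℕ, p 0 = 0 ∧ (∀ n, p (n+1) = p n + if w n = α then 1 else 2) ∧
      (∀ n, x (p n) = α) ∧ (∀ n, x (p n + 1) = w n) := by
  have hs : ∀ n, applyM (Lmor α) (infPrefix w (n+1)) =
      applyM (Lmor α) (infPrefix w n) ++ Lmor α (w n) := by
    intro n
    unfold applyM infPrefix
    rw [List.ofFn_succ_last]
    simp only [List.map_append, List.flatten_append, List.map_cons, List.map_nil,
      List.flatten_cons, List.flatten_nil, List.append_nil]
    rfl
  have h0 : ∀ n, (applyM (Lmor α) (infPrefix w (n+1))).length =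
      (applyM (Lmor α) (infPrefix w n)).length + if w n = α then 1 else 2 := by
    intro n
    rw [hs]; simp only [Lmor]; split_ifs <;> simp
  have h1 : ∀ n, x ((applyM (Lmor α) (infPrefix w n)).length) = α := by
    intro n
    have := hx (n+1) (applyM (Lmor α) (infPrefix w n)).length (by rw [h0]; split_ifs <;> omega)
    rw [← this]
    by_cases h : w n = α <;> simp [hs, Lmor, h]
  refine ⟨fun n => (applyM (Lmor α) (infPrefix w n)).length, ?_, h0, h1, ?_⟩
  · simp [applyM, infPrefix]
  · intro n
    by_cases h : w n = α
    · have := h1 (n+1)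
      rw [h0, if_pos h] at this
      rw [h]; exact this
    · have := hx (n+1) ((applyM (Lmor α) (infPrefix w n)).length + 1)
        (by rw [h0, if_neg h]; omega)
      rw [← this]
      simp [hs, Lmor, h]

theorem fragile_iff_fragile_L {A : Type*} [DecidableEq A] (α a b c : A)
    (hab : a ≠ b) (hbc : b ≠ c) (hac : a ≠ c) (w x : ℕ → A)
    (hx : InfImage (Lmor α) w x) :
    Fragile w a b c ↔ Fragile x a b c := by
  obtain ⟨p, p0, ps, hα, hw⟩ := exists_pos α w x hx
  rw [fragile_iff_fun, fragile_iff_fun]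
  -- last letter of a block
  have hlast : ∀ n, ∃ K, K + 1 = p (n+1) ∧ x K = w n := by
    intro n
    by_cases h : w n = α
    · exact ⟨p n, by rw [ps, if_pos h], by rw [hα, h]⟩
    · exact ⟨p n + 1, by rw [ps, if_neg h], hw n⟩
  have hpos : ∀ i, (∃ n, i = p n) ∨ ∃ n, i = p n + 1 ∧ w n ≠ α := by
    intro i
    induction i with
    | zero => exact Or.inl ⟨0, p0.symm⟩
    | succ i ih =>
      rcases ih with ⟨n, rfl⟩ | ⟨n, rfl, h⟩
      · by_cases h : w n = α
        · exact Or.inl ⟨n+1, by rw [ps, if_pos h]⟩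
        · exact Or.inr ⟨n, rfl, h⟩
      · exact Or.inl ⟨n+1, by rw [ps, if_neg h]⟩
  have hblock : ∀ i, x i = α → ∃ n, i = p n := by
    intro i hi
    rcases hpos i with h | ⟨n, rfl, h⟩
    · exact h
    · exact absurd ((hw n).symm.trans hi) h
  have hnext : ∀ i, x i ≠ α → x (i+1) = α := by
    intro i hi
    rcases hpos i with ⟨n, rfl⟩ | ⟨n, rfl, h⟩
    · exact absurd (hα n) hi
    · have := hα (n+1)
      rwa [ps, if_neg h] at this
  have hmono : StrictMono p := by
    apply strictMono_nat_of_lt_succ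
    intro n; rw [ps]; split_ifs <;> omega
  have hshift : ∀ m n, (∀ i < n, w (m + i) = w i) → p (m + n) = p m + p n := by
    intro m n
    induction n with
    | zero => intro _; simp [p0]
    | succ n ih =>
      intro h
      have h1 := ih (fun i hi => h i (by omega))
      have h2 := h n (by omega)
      rw [← add_assoc, ps, ps, h1, h2, add_assoc]
  have hcopy : ∀ m n, (∀ i < n, w (m + i) = w i) → ∀ i ≤ p n, x (p m + i) = x i := by
    intro m n h i hi
    rcases hpos i with ⟨j, rfl⟩ | ⟨j, rfl, hj⟩
    · have hj' := hmono.le_iff_le.1 hi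
      rw [← hshift m j (fun i hi => h i (by omega)), hα, hα]
    · have hj' : j < n := hmono.lt_iff_lt.1 (by omega)
      rw [← add_assoc, ← hshift m j (fun i hi => h i (by omega)), hw, hw]
      exact h j hj'
  constructor
  · rintro ⟨n, k, l, ha, hne, ⟨h1, h2⟩, h3, h4⟩
    obtain ⟨K, hK, hK'⟩ := hlast k
    obtain ⟨L, hL, hL'⟩ := hlast l
    refine ⟨p n + 1, K, L, by rw [hw, ha], by rwa [hK', hL'], ⟨?_, ?_⟩, ?_, ?_⟩
    · intro i hi; rw [hK]; exact hcopy _ n h1 i (by omega)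
    · rw [hK, ← add_assoc, ← hshift _ n h1, hw, h2]
    · intro i hi; rw [hL]; exact hcopy _ n h3 i (by omega)
    · rw [hL, ← add_assoc, ← hshift _ n h3, hw, h4]
  · rintro ⟨N, K, L, ha, hne, ⟨h1, h2⟩, h3, h4⟩
    have x0 : x 0 = α := by rw [← p0]; exact hα 0
    rcases N with _ | N
    · exfalso
      have hK : x K = α := by
        by_contra h
        exact hab (by rw [← ha, ← h2, x0]; exact (hnext K h).symm)
      have hL : x L = α := by
        by_contra h
        exact hac (by rw [← ha, ← h4, x0]; exact (hnext L h).symm)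
      exact hne (hK.trans hL.symm)
    · have hN : x N = α := by
        by_contra h
        have e1 := hnext N h
        have e2 := hnext (K + 1 + N) (by rw [h1 N (by omega)]; exact h)
        exact hab (by rw [← ha, ← h2, e1]; exact e2.symm)
      obtain ⟨n, rfl⟩ := hblock N hN
      have key : ∀ K b, (∀ i < p n + 1, x (K + 1 + i) = x i) → x (K + 1 + (p n + 1)) = b →
          ∃ k, w k = x K ∧ (∀ i < n, w (k + 1 + i) = w i) ∧ w (k + 1 + n) = b := by
        intro K b h1 h2
        obtain ⟨m, hm⟩ := hblock (K+1) (by rw [← x0]; exact h1 0 (by omega))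
        rcases m with _ | k
        · omega
        obtain ⟨K', hK', hK''⟩ := hlast k
        obtain rfl : K' = K := by omega
        have hall : ∀ i < n, w (k + 1 + i) = w i := by
          intro i
          induction i using Nat.strong_induction_on with
          | _ i ih =>
            intro hi
            have hs := hshift (k+1) i (fun j hj => ih j hj (by omega))
            have := hmono hi
            have e := h1 (p i + 1) (by omega)
            rw [hm, ← add_assoc, ← hs, hw, hw] at e
            exact e
        refine ⟨k, hK''.symm, hall, ?_⟩
        rw [← h2, hm, ← add_assoc, ← hshift _ n hall, hw]
      obtain ⟨k, e1, e2⟩ := key K b h1 h2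
      obtain ⟨l, e3, e4⟩ := key L c h3 h4
      exact ⟨n, k, l, by rw [← hw, ha], by rwa [e1, e3], e2, e4⟩
end

section
/- Every morphism in U(A,B) ∪ P_LSP(A,B) preserves the LSP property for infinite words: if f ∈ U(A,B) ∪ P_LSP(A,B) and w is an infinite LSP word over A, then f(w) is LSP. -/
section Helpers

variable {A : Type*} {B : Type*}

lemma applyM_succ (f : A → List B) (w : ℕ → A) (n : ℕ) :
    applyM f (infPrefix w (n+1)) = applyM f (infPrefix w n) ++ f (w n) := by
  unfold applyM infPrefix
  rw [List.ofFn_succ_last]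
  simp

def posP (f : A → List B) (w : ℕ → A) (n : ℕ) : ℕ := (applyM f (infPrefix w n)).length

lemma posP_zero (f : A → List B) (w : ℕ → A) : posP f w 0 = 0 := by
  simp [posP, applyM, infPrefix]

lemma posP_succ (f : A → List B) (w : ℕ → A) (n : ℕ) :
    posP f w (n+1) = posP f w n + (f (w n)).length := by
  simp [posP, applyM_succ]

lemma image_get (f : A → List B) (w : ℕ → A) (x : ℕ → B) (h : InfImage f w x) (n i : ℕ)
    (hi : i < (f (w n)).length) : x (posP f w n + i) = (f (w n))[i] := by
  have h1 := h (n+1) (posP f w n + i) (by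
    have := posP_succ f w n
    unfold posP at *
    omega)
  rw [← h1]
  simp [applyM_succ, posP]

lemma exists_pos_s12 (f : A → List B) (w : ℕ → A) (hne : Nonerasing f) (m : ℕ) :
    ∃ n i, i < (f (w n)).length ∧ m = posP f w n + i := by
  induction m with
  | zero => exact ⟨0, 0, List.length_pos_iff.2 (hne _), by simp [posP_zero]⟩
  | succ m ih =>
    obtain ⟨n, i, hi, hm⟩ := ih
    by_cases h : i + 1 < (f (w n)).length
    · exact ⟨n, i+1, h, by omega⟩
    · exact ⟨n+1, 0, List.length_pos_iff.2 (hne _), by rw [posP_succ]; omega⟩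

lemma posP_mono (f : A → List B) (w : ℕ → A) : Monotone (posP f w) :=
  monotone_nat_of_le_succ fun n => by rw [posP_succ]; omega

lemma inU_inj [Fintype A] [DecidableEq B] (f : A → List B) (hf : InU f) (a a' : A) (i i' : ℕ)
    (hi : i < (f a).length) (hi' : i' < (f a').length) (h : (f a)[i] = (f a')[i']) :
    a = a' ∧ i = i' := by
  classical
  have hs := hf.2 (f a)[i]
  have h1 : 0 < (f a).count (f a)[i] := List.count_pos_iff.2 (List.getElem_mem hi)
  have h2 : 0 < (f a').count (f a)[i] := by
    rw [h]; exact List.count_pos_iff.2 (List.getElem_mem hi')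
  have haa : a = a' := by
    by_contra hne
    have := Finset.sum_le_sum_of_subset (f := fun c => (f c).count (f a)[i])
      (Finset.subset_univ {a, a'})
    rw [Finset.sum_pair hne] at this
    omega
  subst haa
  refine ⟨rfl, ?_⟩
  have hnd : (f a).Nodup := by
    rw [List.nodup_iff_count_le_one]
    intro b
    exact (Finset.single_le_sum (f := fun c => (f c).count b) (fun _ _ => Nat.zero_le _)
      (Finset.mem_univ a)).trans (hf.2 b)
  exact (hnd.getElem_inj_iff).1 h

/-- block boundary lemma -/
lemma boundary [Fintype A] [DecidableEq B] (f : A → List B) (hf : InU f) (w : ℕ → A)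
    (x : ℕ → B) (hx : InfImage f w x) (k l : ℕ) (h1 : x (k+1) = x (l+1)) (h0 : x k ≠ x l) :
    ∃ n, k + 1 = posP f w (n+1) ∧ k = posP f w n + ((f (w n)).length - 1) := by
  obtain ⟨n, i, hi, hk⟩ := exists_pos_s12 f w hf.1 k
  by_cases h : i + 1 < (f (w n)).length
  · exfalso
    obtain ⟨m, j, hj, hl⟩ := exists_pos_s12 f w hf.1 (l+1)
    have e1 := image_get f w x hx n (i+1) h
    have e2 := image_get f w x hx m j hj
    rw [← hl, ← h1, hk, add_assoc, e1] at e2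
    obtain ⟨hw, hij⟩ := inU_inj f hf _ _ _ _ _ _ e2
    have hl' : l = posP f w m + i := by omega
    apply h0
    rw [hk, hl', image_get f w x hx n i hi, image_get f w x hx m i (by omega)]
    simp only [hw]
  · exact ⟨n, by rw [posP_succ]; omega, by omega⟩

lemma U_preserve [Fintype A] [DecidableEq B] (f : A → List B) (hf : InU f) :
    PreservesLSP f := by
  intro w x hw hx u hu
  obtain ⟨a, b, hab, ⟨k, hk⟩, ⟨l, hl⟩⟩ := hu
  intro t0 ht0
  have hk0 := hk 0 (by simp)
  have hl0 := hl 0 (by simp)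
  simp at hk0 hl0
  have hkt : ∀ t (ht : t < u.length), u[t] = x (k+1+t) := fun t ht => by
    have := hk (t+1) (by simpa using ht)
    rw [show k+1+t = k+(t+1) by omega, ← this]; simp
  have hlt : ∀ t (ht : t < u.length), u[t] = x (l+1+t) := fun t ht => by
    have := hl (t+1) (by simpa using ht)
    rw [show l+1+t = l+(t+1) by omega, ← this]; simp
  have hxx : ∀ t, t < u.length → x (k+1+t) = x (l+1+t) := fun t ht => by
    rw [← hkt t ht, ← hlt t ht]
  have hpos : 0 < u.length := by omega
  have hkl : x k ≠ x l := by rw [← hk0, ← hl0]; exact hab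
  obtain ⟨n, hn1, hn2⟩ := boundary f hf w x hx k l (hxx 0 hpos) hkl
  obtain ⟨m, hm1, hm2⟩ := boundary f hf w x hx l k (hxx 0 hpos).symm hkl.symm
  have hnm : w n ≠ w m := by
    intro h
    have p1 := List.length_pos_iff.2 (hf.1 (w n))
    have p2 := List.length_pos_iff.2 (hf.1 (w m))
    apply hkl
    rw [hn2, hm2, image_get f w x hx n _ (by omega), image_get f w x hx m _ (by omega)]
    simp only [h]
  have key : ∀ s, posP f w (n+1+s) < k+1+u.length →
      posP f w (n+1+s) + (l + 1) = posP f w (m+1+s) + (k+1) ∧ w (n+1+s) = w (m+1+s) ∧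
        ∀ r ≤ s, w (n+1+r) = w (m+1+r) := by
    intro s
    have step : ∀ s, posP f w (n+1+s) < k+1+u.length →
      posP f w (n+1+s) + (l + 1) = posP f w (m+1+s) + (k+1) → w (n+1+s) = w (m+1+s) := by
      intro s h1 h2
      have hm := posP_mono f w (show n+1 ≤ n+1+s by omega)
      have h3 := hxx (posP f w (n+1+s) - (k+1)) (by omega)
      have e1 := image_get f w x hx (n+1+s) 0 (List.length_pos_iff.2 (hf.1 _))
      have e2 := image_get f w x hx (m+1+s) 0 (List.length_pos_iff.2 (hf.1 _))
      rw [show k+1+(posP f w (n+1+s) - (k+1)) = posP f w (n+1+s) + 0 by omega,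
        show l+1+(posP f w (n+1+s) - (k+1)) = posP f w (m+1+s) + 0 by omega, e1, e2] at h3
      exact (inU_inj f hf _ _ _ _ _ _ h3).1
    induction s with
    | zero =>
      intro h
      have h2 : posP f w (n+1+0) + (l + 1) = posP f w (m+1+0) + (k+1) := by
        simp only [add_zero]; omega
      have h3 := step 0 h h2
      refine ⟨h2, h3, fun r hr => ?_⟩
      obtain rfl : r = 0 := by omega
      exact h3
    | succ s ih =>
      intro h
      have hm := posP_mono f w (show n+1+s ≤ n+1+(s+1) by omega)
      obtain ⟨i1, i2, i3⟩ := ih (by omega)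
      have h2 : posP f w (n+1+(s+1)) + (l + 1) = posP f w (m+1+(s+1)) + (k+1) := by
        have a1 := posP_succ f w (n+1+s)
        have a2 := posP_succ f w (m+1+s)
        rw [i2] at a1
        rw [← add_assoc (n+1) s 1, ← add_assoc (m+1) s 1]; omega
      have h3 := step (s+1) h h2
      refine ⟨h2, h3, fun r hr => ?_⟩
      rcases Nat.lt_or_ge s r with h' | h'
      · obtain rfl : r = s+1 := by omega
        exact h3
      · exact i3 r h'
  -- decompose the target position
  obtain ⟨q, i, hi, hq⟩ := exists_pos_s12 f w hf.1 (k+1+t0)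
  have hnq : n + 1 ≤ q := by
    by_contra hlt
    have := posP_mono f w (show q+1 ≤ n+1 by omega)
    rw [posP_succ f w q] at this
    omega
  obtain ⟨s, rfl⟩ := Nat.exists_eq_add_of_le hnq
  obtain ⟨-, -, hr⟩ := key s (by omega)
  have hpre := hw ((List.range (s+1)).map (fun r => w (n+1+r))) ⟨w n, w m, hnm,
    ⟨n, fun j hj => by
      rcases j with _ | j
      · simp
      · simp; congr 1; omega⟩,
    ⟨m, fun j hj => by
      rcases j with _ | j
      · simp
      · simp at hj ⊢
        rw [hr j (by omega)]; congr 1; omega⟩⟩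
  have hpw : ∀ r ≤ s, w (n+1+r) = w r := fun r hrs => by
    have := hpre r (by simp; omega)
    simpa using this
  have hpp : ∀ r ≤ s, posP f w (n+1+r) = posP f w (n+1) + posP f w r := by
    intro r
    induction r with
    | zero => simp [posP_zero]
    | succ r ih =>
      intro h
      have a1 := posP_succ f w (n+1+r)
      have a2 := posP_succ f w r
      have a3 := ih (by omega)
      rw [hpw r (by omega)] at a1
      rw [← add_assoc]; omega
  have e := hpp s le_rfl
  have hw' := hpw s le_rfl
  rw [List.get_eq_getElem, hkt t0 ht0, hq, image_get f w x hx _ i hi,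
    show t0 = posP f w s + i by omega, image_get f w x hx s i (by rw [← hw']; exact hi)]
  simp only [hw']

lemma listPow_add (u : List B) (a b : ℕ) : listPow u (a+b) = listPow u a ++ listPow u b := by
  unfold listPow
  rw [List.replicate_add, List.flatten_append]

lemma PLSP_preserve (f : A → List B) (hf : InPLSP f) : PreservesLSP f := by
  intro w x _ hx
  obtain ⟨-, u, -, hu, h⟩ := hf
  apply h
  have key : ∀ k, ∃ j, applyM f (infPrefix w k) = listPow u (k + j) := by
    intro k
    induction k with
    | zero => exact ⟨0, by simp [applyM, infPrefix, listPow]⟩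
    | succ k ih =>
      obtain ⟨j, hj⟩ := ih
      obtain ⟨c, hc, hfc⟩ := hu (w k)
      refine ⟨j + (c-1), ?_⟩
      rw [applyM_succ, hj, hfc, ← listPow_add]
      congr 1; omega
  intro k i hi
  obtain ⟨j, hj⟩ := key k
  have h1 := hx k
  rw [hj, listPow_add] at h1
  rw [← h1 i (by simp; omega)]
  simp [List.getElem_append_left hi]

end Helpers

/-- all morphisms in `U(A,B) ∪ P_LSP(A,B)` preserve the LSP
property for infinite words. -/
theorem U_PLSP_preserve {A B : Type*} [Fintype A] [DecidableEq B]
    (f : A → List B) (hf : InU f ∨ InPLSP f) : PreservesLSP f := by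
  rcases hf with hf | hf
  · exact U_preserve f hf
  · exact PLSP_preserve f hf
end

section
/- Let w be an infinite LSP word, u a prefix of w, and n ≥ 1 an integer. If u^(n+1) is a factor of w, then u^n is a prefix of w. -/
theorem listPow_length' {A : Type*} (u : List A) (m : ℕ) :
    (listPow u m).length = m * u.length := by
  simp [listPow]

theorem listPow_get' {A : Type*} (u : List A) (m : ℕ) : ∀ (i : ℕ) (h : i < (listPow u m).length)
    (h2 : i % u.length < u.length), (listPow u m)[i] = u[i % u.length] := by
  induction m with
  | zero => intro i h; simp [listPow] at h
  | succ m ih =>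
    intro i h h2
    have e : listPow u (m+1) = u ++ listPow u m := by
      simp [listPow, List.replicate_succ]
    simp only [e]
    rw [List.getElem_append]
    split_ifs with hi
    · simp [Nat.mod_eq_of_lt hi]
    · have hm : (i - u.length) % u.length = i % u.length := (Nat.mod_eq_sub_mod (by omega)).symm
      rw [ih _ _ (by rw [hm]; exact h2)]
      simp [hm]

/-- the factor of `w` of length `L` at position `s`, preceded by a letter. -/
theorem factor_cons' {A : Type*} (w : ℕ → A) (v : List A) (s : ℕ)
    (h : ∀ (i : ℕ) (hi : i < v.length), v[i] = w (s + 1 + i)) : IsFactorI (w s :: v) w := by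
  refine ⟨s, ?_⟩
  intro i hi
  cases i with
  | zero => simp
  | succ i =>
    simp at hi
    simp [h i hi]
    congr 1; omega

/-- if `u` is a prefix of the LSP word `w` and `u^(n+1)` is a factor
of `w` (`n ≥ 1`), then `u^n` is a prefix of `w`. -/
theorem pow_prefix_of_pow_factor {A : Type*} (w : ℕ → A) (hw : IsLSP w)
    (u : List A) (hu : IsPrefixI u w) (n : ℕ) (hn : 1 ≤ n)
    (hfac : IsFactorI (listPow u (n + 1)) w) : IsPrefixI (listPow u n) w := by
  classical
  obtain ⟨k, hk⟩ := hfac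
  rcases Nat.eq_zero_or_pos u.length with h0 | hp
  · intro i h
    rw [listPow_length', h0] at h
    omega
  set p := u.length with hpdef
  have hk' : ∀ i (h : i < (n+1) * p), w (k + i) = u[i % p]'(Nat.mod_lt _ hp) := by
    intro i h
    have h1 : i < (listPow u (n+1)).length := by rw [listPow_length']; exact h
    rw [← hk i h1]
    exact listPow_get' u (n+1) i h1 (Nat.mod_lt _ hp)
  have hmul : (n+1) * p = n * p + p := by ring
  have hex : ∃ j, j ≤ k ∧ ∀ i, j ≤ i → i < k + n * p → w i = w (i + p) := by
    refine ⟨k, le_rfl, ?_⟩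
    intro i h1 h2
    obtain ⟨m, rfl⟩ := Nat.exists_eq_add_of_le h1
    rw [hk' m (by omega), add_assoc, hk' (m + p) (by omega)]
    simp
  have hper : ∀ i, i + p < n * p → w i = w (i + p) := by
    obtain ⟨hjk, hj⟩ := Nat.find_spec hex
    have hmin := fun m => @Nat.find_min _ _ hex m
    generalize Nat.find hex = j at *
    cases j with
    | zero => intro i hi; exact hj i (by omega) (by omega)
    | succ j =>
      have hne : w j ≠ w (j + p) := by
        intro he
        apply hmin j (by omega)
        refine ⟨by omega, ?_⟩
        intro i h1 h2
        rcases Nat.eq_or_lt_of_le h1 with h | h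
        · rw [← h]; exact he
        · exact hj i h h2
      have hpre : IsPrefixI (List.ofFn (fun i : Fin (n * p) => w (j + 1 + i))) w := by
        apply hw
        refine ⟨w j, w (j + p), hne, factor_cons' _ _ _ ?_, factor_cons' _ _ _ ?_⟩
        · intro i hi; simp
        · intro i hi
          simp at hi
          simp only [List.getElem_ofFn]
          rw [hj (j+1+i) (by omega) (by omega)]
          congr 1; omega
      have hv : ∀ i, i < n * p → w i = w (j + 1 + i) := by
        intro i hi
        have := hpre i (by simpa using hi)
        simpa using this.symm
      intro i hi
      rw [hv i (by omega), hv (i+p) hi, hj (j+1+i) (by omega) (by omega)]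
      congr 1; omega
  have hfin : ∀ i, i < n * p → w i = u[i % p]'(Nat.mod_lt _ hp) := by
    intro i
    induction i using Nat.strong_induction_on with
    | _ i ih =>
      intro hi
      rcases Nat.lt_or_ge i p with h | h
      · have := hu i h
        simp only [Nat.mod_eq_of_lt h]
        simpa using this.symm
      · obtain ⟨m, rfl⟩ := Nat.exists_eq_add_of_le' h
        rw [← hper m hi, ih m (by omega) (by omega)]
        simp
  intro i h
  have h' := h
  rw [listPow_length'] at h'
  rw [hfin i h']
  exact listPow_get' u n i h (Nat.mod_lt _ hp)
end

section
/- Let f : A* → B* be a nonerasing morphism that preserves the LSP property for infinite words. If there exist two distinct letters a and b of A such that f(a) and f(b) have the same primitive root, then f(α) is a positive power of the primitive root of f(a) for every letter α of A (i.e., f ∈ P_LSP(A,B)). -/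
theorem lp_succ {B : Type*} (u : List B) (k : ℕ) : listPow u (k+1) = u ++ listPow u k := by
  simp [listPow, List.replicate_succ]

theorem lp_zero {B : Type*} (u : List B) : listPow u 0 = [] := by
  simp [listPow]

theorem lp_add {B : Type*} (u : List B) (m n : ℕ) :
    listPow u (m+n) = listPow u m ++ listPow u n := by
  induction m with
  | zero => simp [lp_zero]
  | succ m ih => rw [show m + 1 + n = (m+n)+1 by omega, lp_succ, lp_succ, ih, List.append_assoc]

theorem lp_one {B : Type*} (u : List B) : listPow u 1 = u := by
  simp [listPow]

theorem lp_mul {B : Type*} (u : List B) (m n : ℕ) :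
    listPow (listPow u m) n = listPow u (m*n) := by
  induction n with
  | zero => simp [lp_zero]
  | succ n ih => rw [lp_succ, ih, Nat.mul_succ, Nat.add_comm, lp_add]

theorem lp_length {B : Type*} (u : List B) (m : ℕ) : (listPow u m).length = m * u.length := by
  simp [listPow]

theorem comm_pow {B : Type*} : ∀ (N : ℕ) (u v : List B), u.length + v.length ≤ N →
    u ++ v = v ++ u → ∃ z m n, u = listPow z m ∧ v = listPow z n := by
  intro N
  induction N with
  | zero =>
    intro u v h _
    have hu : u = [] := List.length_eq_zero_iff.1 (by omega)
    have hv : v = [] := List.length_eq_zero_iff.1 (by omega)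
    exact ⟨[], 0, 0, by simp [hu, lp_zero], by simp [hv, lp_zero]⟩
  | succ N ih =>
    have key : ∀ u v : List B, u.length ≤ v.length → u.length + v.length ≤ N + 1 →
        u ++ v = v ++ u → ∃ z m n, u = listPow z m ∧ v = listPow z n := by
      intro u v hl h e
      by_cases hu : u = []
      · exact ⟨v, 0, 1, by simp [hu, lp_zero], by simp [lp_one]⟩
      have hp : u <+: v := by
        refine List.prefix_of_prefix_length_le (l₃ := u ++ v) (List.prefix_append _ _) ?_ hl
        rw [e]; exact List.prefix_append _ _
      obtain ⟨t, rfl⟩ := hp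
      have hpos := List.length_pos_iff.2 hu
      have e2 : u ++ t = t ++ u := by
        rw [List.append_assoc] at e
        exact List.append_cancel_left e
      obtain ⟨z, m, n, h1, h2⟩ := ih u t (by simp at h; omega) e2
      exact ⟨z, m, m+n, h1, by rw [lp_add, ← h1, ← h2]⟩
    intro u v h e
    rcases le_total u.length v.length with hl | hl
    · exact key u v hl h e
    · obtain ⟨z, m, n, h1, h2⟩ := key v u hl (by omega) e.symm
      exact ⟨z, n, m, h2, h1⟩

theorem split_ne {B : Type*} : ∀ (l1 l2 : List B), l1.length = l2.length → l1 ≠ l2 →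
    ∃ q x y s1 s2, l1 = q ++ x :: s1 ∧ l2 = q ++ y :: s2 ∧ x ≠ y
  | [], [], _, h => absurd rfl h
  | [], _ :: _, h, _ => by simp at h
  | _ :: _, [], h, _ => by simp at h
  | x :: l1, y :: l2, h, hn => by
    by_cases hxy : x = y
    · subst hxy
      obtain ⟨q, a, b, s1, s2, h1, h2, h3⟩ := split_ne l1 l2 (by simpa using h)
        (fun e => hn (by rw [e]))
      exact ⟨x :: q, a, b, s1, s2, by simp [h1], by simp [h2], h3⟩
    · exact ⟨[], x, y, l1, l2, rfl, rfl, hxy⟩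

theorem split_ne_rev {B : Type*} (l1 l2 : List B) (hl : l1.length = l2.length) (hn : l1 ≠ l2) :
    ∃ t x y s1 s2, l1 = s1 ++ x :: t ∧ l2 = s2 ++ y :: t ∧ x ≠ y := by
  obtain ⟨q, x, y, s1, s2, h1, h2, h3⟩ := split_ne l1.reverse l2.reverse (by simpa using hl)
    (fun e => hn (List.reverse_injective e))
  refine ⟨q.reverse, x, y, s1.reverse, s2.reverse, ?_, ?_, h3⟩
  · rw [← List.reverse_reverse l1, h1]; simp
  · rw [← List.reverse_reverse l2, h2]; simp

def omegaW {B : Type*} (l : List B) (h : 0 < l.length) : ℕ → B :=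
  fun n => l[n % l.length]'(Nat.mod_lt _ h)

theorem omegaW_prefix {B : Type*} (l : List B) (h : 0 < l.length) (m : ℕ) :
    IsPrefixI (listPow l m) (omegaW l h) := by
  induction m with
  | zero => intro i hi; simp [lp_zero] at hi
  | succ m ih =>
    intro i hi
    simp only [lp_succ, List.get_eq_getElem]
    by_cases hl : i < l.length
    · rw [List.getElem_append_left hl]
      simp [omegaW, Nat.mod_eq_of_lt hl]
    · push Not at hl
      rw [List.getElem_append_right hl]
      have := ih (i - l.length) (by simp only [lp_succ, List.length_append] at hi; omega)
      simp only [List.get_eq_getElem] at this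
      rw [this]
      simp [omegaW, Nat.mod_eq_sub_mod hl]

theorem pre_mono {B : Type*} {l1 l2 : List B} {w : ℕ → B} (h : l1 <+: l2)
    (h2 : IsPrefixI l2 w) : IsPrefixI l1 w := by
  obtain ⟨t, rfl⟩ := h
  intro i hi
  have := h2 i (by simp; omega)
  simp only [List.get_eq_getElem] at this ⊢
  rw [← this, List.getElem_append_left hi]

theorem fac_of {B : Type*} {l : List B} {w : ℕ → B} (h : IsPrefixI l w) (p m s : List B)
    (e : l = p ++ (m ++ s)) : IsFactorI m w := by
  subst e
  refine ⟨p.length, fun i hi => ?_⟩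
  have := h (p.length + i) (by simp; omega)
  simp only [List.get_eq_getElem] at this ⊢
  rw [← this, List.getElem_append_right (by omega)]
  simp [List.getElem_append_left hi]

theorem pre_at {B : Type*} {q s : List B} {x : B} {w : ℕ → B} (h : IsPrefixI (q ++ x :: s) w) :
    w q.length = x := by
  have := h q.length (by simp)
  rw [← this]; simp

theorem infPre {A : Type*} (l : List A) (h : 0 < l.length) (n : ℕ) :
    infPrefix (omegaW l h) n <+: listPow l n := by
  have hn : n ≤ (listPow l n).length := by
    rw [lp_length]; exact Nat.le_mul_of_pos_right _ h
  have : infPrefix (omegaW l h) n = (listPow l n).take n := by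
    apply List.ext_getElem
    · simp [infPrefix]; exact hn
    · intro i h1 h2
      have hi : i < n := by simpa [infPrefix] using h1
      have := omegaW_prefix l h n i (by omega)
      simp only [List.get_eq_getElem] at this
      simp [infPrefix, this]
  rw [this]; exact List.take_prefix _ _

theorem applyM_append {A B : Type*} (f : A → List B) (x y : List A) :
    applyM f (x ++ y) = applyM f x ++ applyM f y := by simp [applyM]

theorem applyM_pow {A B : Type*} (f : A → List B) (x : List A) (n : ℕ) :
    applyM f (listPow x n) = listPow (applyM f x) n := by
  induction n with
  | zero => simp [lp_zero, applyM]
  | succ n ih => rw [lp_succ, lp_succ, applyM_append, ih]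

theorem omega_image {A B : Type*} (f : A → List B) (l : List A) (h : 0 < l.length)
    (h' : 0 < (applyM f l).length) : InfImage f (omegaW l h) (omegaW (applyM f l) h') := by
  intro n
  obtain ⟨t, ht⟩ := infPre l h n
  refine pre_mono ?_ (omegaW_prefix _ h' n)
  rw [← applyM_pow, ← ht, applyM_append]
  exact List.prefix_append _ _

theorem omega_LSP {A : Type*} (l : List A) (h : 0 < l.length) (hd : l.Nodup) :
    IsLSP (omegaW l h) := by
  rintro u ⟨x, y, hxy, ⟨k, hk⟩, ⟨m, hm⟩⟩
  cases u with
  | nil => intro i hi; simp at hi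
  | cons z u =>
    exfalso
    apply hxy
    have k0 := hk 0 (by simp)
    have k1 := hk 1 (by simp)
    have m0 := hm 0 (by simp)
    have m1 := hm 1 (by simp)
    simp only [List.get_eq_getElem, List.getElem_cons_zero, List.getElem_cons_succ,
      Nat.add_zero] at k0 k1 m0 m1
    have e : (k + 1) % l.length = (m+1) % l.length := by
      have := k1.symm.trans m1
      simp only [omegaW] at this
      exact (List.Nodup.getElem_inj_iff hd).1 this
    have e2 : k % l.length = m % l.length := Nat.ModEq.add_right_cancel' 1 e
    rw [k0, m0]
    simp only [omegaW, e2]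

theorem q_pre {B : Type*} (u v q s : List B) (x : B) (hu : u ≠ []) (h1 : u ++ v = q ++ x :: s)
    (h2 : q <+: v ++ u) (n : ℕ) : q ++ [x] <+: listPow u (n+1) ++ (v ++ u) := by
  have h0 : q ++ [x] <+: u ++ (v ++ u) := by
    rw [← List.append_assoc, h1]; exact ⟨s ++ u, by simp⟩
  induction n with
  | zero => simpa [lp_one] using h0
  | succ n ih =>
    have hpos := List.length_pos_iff.2 hu
    have h3 : q ++ [x] <+: u ++ q :=
      List.prefix_of_prefix_length_le h0 ((List.prefix_append_right_inj u).2 h2)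
        (by simp; omega)
    rw [lp_succ, List.append_assoc]
    refine h3.trans ((List.prefix_append_right_inj u).2 ?_)
    exact (List.prefix_append q [x]).trans ih

theorem main_comm {B : Type*} (u v : List B) (K : ℕ) (hK : 0 < K) (hu : u ≠ [])
    (X Y : ℕ → B) (hX : IsLSP X)
    (h1 : IsPrefixI (listPow (v ++ listPow u (K+1)) 3) X)
    (h2 : IsPrefixI (listPow (listPow u (K+1) ++ v) 2) Y) 
    (hXY : ∀ L : List B, LeftSpecialI L X → IsPrefixI L Y) : u ++ v = v ++ u := by
  by_contra hn
  have hl : (u ++ v).length = (v ++ u).length := by simp; omega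
  obtain ⟨q, x, y, s1, s2, e1, e2, hxy⟩ := split_ne _ _ hl hn
  obtain ⟨t, x', y', r1, r2, e3, e4, hxy'⟩ := split_ne_rev _ _ hl hn
  have hpos := List.length_pos_iff.2 hu
  have P1 : listPow u (K+1) = u ++ listPow u K := lp_succ u K
  have P2 : listPow u (K+1) = listPow u K ++ u := by rw [lp_add, lp_one]
  have hLS : LeftSpecialI (t ++ (listPow u K ++ q)) X := by
    refine ⟨x', y', hxy', ?_, ?_⟩
    · refine fac_of h1 (v ++ listPow u K ++ r1) _ (x :: s1 ++ listPow u (K+1)) ?_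
      calc listPow (v ++ listPow u (K+1)) 3
          = v ++ listPow u (K+1) ++ (v ++ listPow u (K+1)) ++ (v ++ listPow u (K+1)) := by
            simp [listPow, List.replicate_succ]
        _ = v ++ (listPow u K ++ u) ++ (v ++ (listPow u K ++ u)) ++ (v ++ listPow u (K+1)) := by
            rw [← P2]
        _ = v ++ listPow u K ++ (u ++ v) ++ listPow u K ++ (u ++ v) ++ listPow u (K+1) := by
            simp
        _ = v ++ listPow u K ++ (r1 ++ x' :: t) ++ listPow u K ++ (q ++ x :: s1)
            ++ listPow u (K+1) := by rw [← e3, ← e1]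
        _ = _ := by simp
    · refine fac_of h1 r2 _ (y :: s2 ++ listPow u K ++ (v ++ listPow u (K+1))) ?_
      calc listPow (v ++ listPow u (K+1)) 3
          = v ++ listPow u (K+1) ++ (v ++ listPow u (K+1)) ++ (v ++ listPow u (K+1)) := by
            simp [listPow, List.replicate_succ]
        _ = v ++ (u ++ listPow u K) ++ (v ++ (u ++ listPow u K)) ++ (v ++ listPow u (K+1)) := by
            rw [← P1]
        _ = (v ++ u) ++ listPow u K ++ (v ++ u) ++ listPow u K ++ (v ++ listPow u (K+1)) := by
            simp
        _ = (r2 ++ y' :: t) ++ listPow u K ++ (q ++ y :: s2)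
            ++ listPow u K ++ (v ++ listPow u (K+1)) := by rw [← e4, ← e2]
        _ = _ := by simp
  have hlen : q.length < (t ++ (listPow u K ++ q)).length := by
    have := Nat.mul_pos hK hpos
    simp only [List.length_append, lp_length]; omega
  have a1 := hX _ hLS _ hlen
  have a2 := hXY _ hLS _ hlen
  have b1 : X q.length = y := by
    refine pre_at (s := s2) (pre_mono ?_ h1)
    rw [← e2]
    refine ⟨listPow u K ++ listPow (v ++ listPow u (K+1)) 2, ?_⟩
    rw [lp_succ _ 2, P1]; simp
  have b2 : Y q.length = x := by
    refine pre_at (s := []) (pre_mono ?_ h2)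
    refine (q_pre u v q s1 x hu e1 ⟨_, e2.symm⟩ K).trans ?_
    refine ⟨listPow u K ++ v, ?_⟩
    rw [lp_succ _ 1, lp_one]
    conv_rhs => rw [P1]
    rw [P1]; simp
  exact hxy (by rw [← b1, ← b2, ← a1, ← a2])

theorem omegaW_congr {B : Type*} {l l' : List B} (e : l = l') (h : 0 < l.length) :
    omegaW l h = omegaW l' (e ▸ h) := by
  subst e; rfl

theorem omegaW_shift {B : Type*} (p q : List B) (h1 : 0 < (p ++ q).length)
    (h2 : 0 < (q ++ p).length) (n : ℕ) :
    omegaW (p ++ q) h1 n = omegaW (q ++ p) h2 (n + q.length) := by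
  simp only [omegaW]
  have hL : (q ++ p).length = (p ++ q).length := by simp; omega
  have hm := Nat.mod_lt n h1
  have hLL : (p ++ q).length = p.length + q.length := by simp
  by_cases hc : n % (p ++ q).length < p.length
  · have e : (n + q.length) % (q ++ p).length = n % (p ++ q).length + q.length := by
      rw [hL, Nat.add_mod, ← Nat.mod_add_mod]
      rw [Nat.mod_mod, Nat.add_mod_mod]
      exact Nat.mod_eq_of_lt (by omega)
    rw [List.getElem_append_left hc]
    simp only [e]
    rw [List.getElem_append_right (by omega)]
    simp
  · have e : (n + q.length) % (q ++ p).length = n % (p ++ q).length - p.length := by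
      rw [hL, ← Nat.mod_add_mod, Nat.mod_eq_sub_mod (by omega)]
      rw [Nat.mod_eq_of_lt (by omega)]
      omega
    rw [List.getElem_append_right (by omega)]
    simp only [e]
    rw [List.getElem_append_left (by omega)]

theorem same_primroot_implies_periodic {A B : Type*} (f : A → List B)
    (hne : Nonerasing f) (hpres : PreservesLSP f) (a b : A) (hab : a ≠ b)
    (r : List B) (hra : IsPrimRoot r (f a)) (hrb : IsPrimRoot r (f b)) :
    ∀ α : A, ∃ k : ℕ, 0 < k ∧ f α = listPow r k := by
  intro c
  by_cases hca : c = a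
  · subst hca; exact hra.1
  by_cases hcb : c = b
  · subst hcb; exact hrb.1
  obtain ⟨⟨i, hi, hia⟩, hmin⟩ := hra
  obtain ⟨⟨j, hj, hjb⟩, -⟩ := hrb
  have hr : r ≠ [] := by
    rintro rfl
    apply hne a; rw [hia]; simp [listPow]
  have hpc := List.length_pos_iff.2 (hne c)
  obtain ⟨K, hK, hKe⟩ : ∃ K, 0 < K ∧ f a ++ f b = listPow r (K+1) :=
    ⟨i + j - 1, by omega, by rw [hia, hjb, ← lp_add]; congr 1; omega⟩
  have E1 : applyM f [c, a, b] = f c ++ listPow r (K+1) := by simp [applyM, ← hKe]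
  have E2 : applyM f [a, b, c] = listPow r (K+1) ++ f c := by simp [applyM, ← hKe]
  have p1 : 0 < (applyM f [c, a, b]).length := by rw [E1]; simp; omega
  have p2 : 0 < (applyM f [a, b, c]).length := by rw [E2]; simp; omega
  have L1 := hpres _ _ (omega_LSP [c, a, b] (by simp) (by simp [hca, hcb, hab]))
    (omega_image f _ _ p1)
  have L2 := hpres _ _ (omega_LSP [a, b, c] (by simp)
    (by simp [Ne.symm hca, Ne.symm hcb, hab])) (omega_image f _ _ p2)
  have hcomm : r ++ f c = f c ++ r := by
    refine main_comm r (f c) K hK hr _ _ L1 (by rw [← E1]; exact omegaW_prefix _ p1 3)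
      (by rw [← E2]; exact omegaW_prefix _ p2 2) ?_
    -- factors of both periodic words coincide
    have shift : ∀ n, omegaW _ p1 n = omegaW _ p2 (n + (listPow r (K+1)).length) := by
      intro n
      rw [omegaW_congr E1 p1, omegaW_congr E2 p2]
      exact omegaW_shift _ _ _ _ n
    rintro L ⟨x, y, hxy, ⟨k, hk⟩, ⟨m, hm⟩⟩
    refine L2 L ⟨x, y, hxy, ⟨k + (listPow r (K+1)).length, fun i h => ?_⟩,
      ⟨m + (listPow r (K+1)).length, fun i h => ?_⟩⟩
    · rw [hk i h, shift]; congr 1; omega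
    · rw [hm i h, shift]; congr 1; omega
  obtain ⟨z, m, n, h1, h2⟩ := comm_pow _ r (f c) le_rfl hcomm
  have hz := hmin z (m * i) (by
    rcases Nat.eq_zero_or_pos m with h | h
    · subst h; exact absurd (by simpa [lp_zero] using h1) hr
    · exact Nat.mul_pos h hi) (by rw [hia, h1, lp_mul])
  have hrl := List.length_pos_iff.2 hr
  have hm : m = 1 := by
    have := congrArg List.length h1
    rw [lp_length] at this
    have : m * z.length ≤ 1 * z.length := by omega
    have h3 := Nat.le_of_mul_le_mul_right this (by nlinarith)
    have : m ≠ 0 := by rintro rfl; omega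
    omega
  subst hm
  rw [lp_one] at h1
  subst h1
  refine ⟨n, Nat.pos_of_ne_zero ?_, h2⟩
  rintro rfl
  exact hne c (by simpa [lp_zero] using h2)
end
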